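/- arXiv:1705.09416 — 6 statements merged into one kernel-verified Lean document; each statement's English description precedes it below -/
import Mathlib

section
/- Let p : ℝ → ℝ be continuous and strictly positive on [0,∞), let ψ < 0, and let φ_g ≥ 0 and φ_h ≥ 0 be real numbers. Define g(t) = ∫₀ᵗ (φ_g + ψ·x)·p(x) dx and h(t) = ∫₀ᵗ (φ_h + ψ·x)·p(x) dx for t ≥ 0. Then sup_{t ≥ 0} g(t) ≥ sup_{t ≥ 0} h(t) if and only if φ_g ≥ φ_h. -/
open MeasureTheory intervalIntegral

theorem intervalIntegrable_affine_mul {p : ℝ → ℝ} (hp : ContinuousOn p (Set.Ici (0:ℝ)))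
    (φ ψ : ℝ) {a b : ℝ} (ha : 0 ≤ a) (hb : 0 ≤ b) :
    IntervalIntegrable (fun x => (φ + ψ * x) * p x) volume a b := by
  apply ContinuousOn.intervalIntegrable
  have hsub : Set.uIcc a b ⊆ Set.Ici (0:ℝ) := fun x hx => (le_min ha hb).trans hx.1
  exact ContinuousOn.mul (by fun_prop) (hp.mono hsub)

/-- The utility is maximal where its integrand changes sign. -/
theorem isGreatest_integral_affine_mul {p : ℝ → ℝ} (hp : ContinuousOn p (Set.Ici (0:ℝ)))
    (hp_nonneg : ∀ x, 0 ≤ x → 0 ≤ p x) {φ ψ : ℝ} (hφ : 0 ≤ φ) (hψ : ψ < 0) :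
    IsGreatest ((fun t => ∫ x in (0:ℝ)..t, (φ + ψ * x) * p x) '' Set.Ici (0:ℝ))
      (∫ x in (0:ℝ)..(φ / -ψ), (φ + ψ * x) * p x) := by
  have hψ' : 0 < -ψ := neg_pos.mpr hψ
  have hT : 0 ≤ φ / -ψ := div_nonneg hφ hψ'.le
  refine ⟨⟨_, hT, rfl⟩, ?_⟩
  rintro _ ⟨t, ht, rfl⟩
  rw [Set.mem_Ici] at ht
  have hadd := integral_add_adjacent_intervals
    (intervalIntegrable_affine_mul hp φ ψ le_rfl ht)
    (intervalIntegrable_affine_mul hp φ ψ ht hT)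
  suffices 0 ≤ ∫ x in t..(φ / -ψ), (φ + ψ * x) * p x by
    dsimp only
    linarith
  rcases le_total t (φ / -ψ) with h | h
  · refine integral_nonneg h fun x hx => mul_nonneg ?_ (hp_nonneg x (ht.trans hx.1))
    have := (le_div_iff₀ hψ').mp hx.2
    linarith
  · rw [integral_symm, ← intervalIntegral.integral_neg]
    refine integral_nonneg h fun x hx => ?_
    rw [← neg_mul]
    refine mul_nonneg ?_ (hp_nonneg x (hT.trans hx.1))
    have := (div_le_iff₀ hψ').mp hx.1
    linarith

theorem strictMonoOn_integral_affine_mul {p : ℝ → ℝ} (hp : ContinuousOn p (Set.Ici (0:ℝ)))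
    (hp_pos : ∀ x, 0 ≤ x → 0 < p x) {ψ : ℝ} (hψ : ψ < 0) :
    StrictMonoOn (fun φ => ∫ x in (0:ℝ)..(φ / -ψ), (φ + ψ * x) * p x) (Set.Ici (0:ℝ)) := by
  intro φ₁ h₁ φ₂ h₂ hlt
  rw [Set.mem_Ici] at h₁ h₂
  have hψ' : 0 < -ψ := neg_pos.mpr hψ
  have hT₁ : 0 ≤ φ₁ / -ψ := div_nonneg h₁ hψ'.le
  have hT₂ : 0 ≤ φ₂ / -ψ := div_nonneg h₂ hψ'.le
  have hT : φ₁ / -ψ < φ₂ / -ψ := div_lt_div_of_pos_right hlt hψ'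
  have hadd := integral_add_adjacent_intervals
    (intervalIntegrable_affine_mul hp φ₂ ψ le_rfl hT₁)
    (intervalIntegrable_affine_mul hp φ₂ ψ hT₁ hT₂)
  have hpos : 0 < ∫ x in (φ₁ / -ψ)..(φ₂ / -ψ), (φ₂ + ψ * x) * p x := by
    refine intervalIntegral_pos_of_pos_on (intervalIntegrable_affine_mul hp φ₂ ψ hT₁ hT₂)
      (fun x hx => mul_pos ?_ (hp_pos x (hT₁.trans hx.1.le))) hT
    have := (lt_div_iff₀ hψ').mp hx.2
    linarith
  have hmono : ∫ x in (0:ℝ)..(φ₁ / -ψ), (φ₁ + ψ * x) * p x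
      ≤ ∫ x in (0:ℝ)..(φ₁ / -ψ), (φ₂ + ψ * x) * p x :=
    integral_mono_on hT₁ (intervalIntegrable_affine_mul hp φ₁ ψ le_rfl hT₁)
      (intervalIntegrable_affine_mul hp φ₂ ψ le_rfl hT₁)
      fun x hx => mul_le_mul_of_nonneg_right (by linarith) (hp_pos x hx.1).le
  dsimp only
  linarith

theorem utility_sup_comparison
    (p : ℝ → ℝ)
    (hp_cont : ContinuousOn p (Set.Ici (0:ℝ)))
    (hp_pos : ∀ x, 0 ≤ x → 0 < p x)
    (ψ : ℝ) (hψ : ψ < 0)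
    (φg φh : ℝ) (hφg : 0 ≤ φg) (hφh : 0 ≤ φh)
    (g h : ℝ → ℝ)
    (hg : ∀ t, g t = ∫ x in (0:ℝ)..t, (φg + ψ * x) * p x)
    (hh : ∀ t, h t = ∫ x in (0:ℝ)..t, (φh + ψ * x) * p x) :
    sSup (g '' Set.Ici (0:ℝ)) ≥ sSup (h '' Set.Ici (0:ℝ)) ↔ φg ≥ φh := by
  have hp_nonneg : ∀ x, 0 ≤ x → 0 ≤ p x := fun x hx => (hp_pos x hx).le
  rw [funext hg, funext hh,
    (isGreatest_integral_affine_mul hp_cont hp_nonneg hφg hψ).csSup_eq,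
    (isGreatest_integral_affine_mul hp_cont hp_nonneg hφh hψ).csSup_eq]
  exact (strictMonoOn_integral_affine_mul hp_cont hp_pos hψ).le_iff_le hφh hφg
end

section
/- Strong duality for the augmented MMKP: let N, M, K be natural numbers, W : Fin N → Fin M → Fin K → ℝ → ℝ, and B : Fin K → ℝ. Assume each function W i j k : ℝ → ℝ is convex and continuous, W i j k 0 = 0 for all i, j, k, and B k > 0 for all k. Then the supremum of Σ_{i,j} x i j · V i j over all primal feasible pairs (x, V) equals the infimum of Σ_k α k · B k + Σ_i β i over all dual feasible pairs (α, β), where both sides are taken as extended real numbers. -/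
/-- Primal feasibility for the augmented MMKP. -/
def PrimalFeasible {N M K : ℕ} (W : Fin N → Fin M → Fin K → ℝ → ℝ)
    (B : Fin K → ℝ) (x V : Fin N → Fin M → ℝ) : Prop :=
  (∀ i j, 0 ≤ x i j) ∧ (∀ i, ∑ j, x i j ≤ 1) ∧
    (∀ k, ∑ i, ∑ j, x i j * W i j k (V i j) ≤ B k)

/-- Dual feasibility for the augmented MMKP. -/
def DualFeasible {N M K : ℕ} (W : Fin N → Fin M → Fin K → ℝ → ℝ)
    (α : Fin K → ℝ) (β : Fin N → ℝ) : Prop :=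
  (∀ k, 0 ≤ α k) ∧ (∀ i, 0 ≤ β i) ∧
    (∀ i j (v : ℝ), v - ∑ k, α k * W i j k v ≤ β i)

/-- A resource allocation: nonnegative weights whose row sums are at most one. -/
def IsAllocation {N M : ℕ} (x : Fin N → Fin M → ℝ) : Prop :=
  (∀ i j, 0 ≤ x i j) ∧ ∀ i, ∑ j, x i j ≤ 1

/-- The pairs of a gain and a resource vector that some allocation strictly improves upon. -/
def strictlyAttainable {N M K : ℕ} (W : Fin N → Fin M → Fin K → ℝ → ℝ) :
    Set (ℝ × (Fin K → ℝ)) :=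
  {p | ∃ x V : Fin N → Fin M → ℝ, IsAllocation x ∧ p.1 < ∑ i, ∑ j, x i j * V i j ∧
    ∀ k, ∑ i, ∑ j, x i j * W i j k (V i j) < p.2 k}

theorem isOpen_strictlyAttainable {N M K : ℕ} (W : Fin N → Fin M → Fin K → ℝ → ℝ) :
    IsOpen (strictlyAttainable W) := by
  have h : strictlyAttainable W = ⋃ (x : Fin N → Fin M → ℝ) (V : Fin N → Fin M → ℝ)
      (_ : IsAllocation x), {p : ℝ × (Fin K → ℝ) | p.1 < ∑ i, ∑ j, x i j * V i j ∧
        ∀ k, ∑ i, ∑ j, x i j * W i j k (V i j) < p.2 k} := by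
    ext p
    simp [strictlyAttainable, and_left_comm]
  rw [h]
  refine isOpen_iUnion fun x => isOpen_iUnion fun V => isOpen_iUnion fun _ => ?_
  refine (isOpen_lt continuous_fst continuous_const).inter ?_
  change IsOpen {p : ℝ × (Fin K → ℝ) | ∀ k, ∑ i, ∑ j, x i j * W i j k (V i j) < p.2 k}
  simp only [Set.ofPred_forall]
  exact isOpen_iInter_of_finite fun k => isOpen_lt continuous_const (by fun_prop)

/-- The perspective of a convex function is jointly convex. -/
theorem ConvexOn.perspective_le {g : ℝ → ℝ} (hg : ConvexOn ℝ Set.univ g) {y y' : ℝ}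
    (hy : 0 ≤ y) (hy' : 0 ≤ y') (v v' : ℝ) :
    (y + y') * g ((y * v + y' * v') / (y + y')) ≤ y * g v + y' * g v' := by
  rcases (add_nonneg hy hy').eq_or_lt with h | h
  · have h1 : y = 0 := by linarith
    have h2 : y' = 0 := by linarith
    simp [h1, h2]
  · have key := hg.2 (Set.mem_univ v) (Set.mem_univ v') (div_nonneg hy h.le)
      (div_nonneg hy' h.le) (by field_simp)
    simp only [smul_eq_mul] at key
    have e : y / (y + y') * v + y' / (y + y') * v' = (y * v + y' * v') / (y + y') := by ring
    rw [e] at key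
    calc _ ≤ (y + y') * (y / (y + y') * g v + y' / (y + y') * g v') :=
          mul_le_mul_of_nonneg_left key h.le
      _ = _ := by field_simp

theorem convex_strictlyAttainable {N M K : ℕ} {W : Fin N → Fin M → Fin K → ℝ → ℝ}
    (hconv : ∀ i j k, ConvexOn ℝ Set.univ (W i j k)) : Convex ℝ (strictlyAttainable W) := by
  rw [convex_iff_forall_pos]
  rintro p ⟨x, V, ⟨hx, hx1⟩, hp, hpk⟩ q ⟨x', V', ⟨hx', hx1'⟩, hq, hqk⟩ a b ha hb hab
  refine ⟨fun i j => a * x i j + b * x' i j, fun i j =>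
    (a * x i j * V i j + b * x' i j * V' i j) / (a * x i j + b * x' i j),
    ⟨fun i j => ?_, fun i => ?_⟩, ?_, fun k => ?_⟩
  · have := hx i j
    have := hx' i j
    positivity
  · rw [Finset.sum_add_distrib, ← Finset.mul_sum, ← Finset.mul_sum]
    nlinarith [hx1 i, hx1' i]
  · have e : ∀ i j, (a * x i j + b * x' i j) *
        ((a * x i j * V i j + b * x' i j * V' i j) / (a * x i j + b * x' i j)) =
        a * (x i j * V i j) + b * (x' i j * V' i j) := by
      intro i j
      rw [mul_div_cancel_of_imp']
      · ring
      · intro h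
        have h1 := mul_nonneg ha.le (hx i j)
        have h2 := mul_nonneg hb.le (hx' i j)
        have h3 : a * x i j = 0 := by linarith
        have h4 : b * x' i j = 0 := by linarith
        simp [h3, h4]
    simp only [e, Finset.sum_add_distrib, ← Finset.mul_sum, Prod.fst_add, Prod.smul_fst,
      smul_eq_mul]
    gcongr
  · calc _ ≤ ∑ i, ∑ j, (a * (x i j * W i j k (V i j)) + b * (x' i j * W i j k (V' i j))) := by
          gcongr with i _ j _
          simpa only [mul_assoc] using (hconv i j k).perspective_le
            (mul_nonneg ha.le (hx i j)) (mul_nonneg hb.le (hx' i j)) (V i j) (V' i j)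
      _ < _ := by
          simp only [Finset.sum_add_distrib, ← Finset.mul_sum, Prod.snd_add, Prod.smul_snd,
            smul_eq_mul, Pi.add_apply, Pi.smul_apply]
          have h1 := hpk k
          have h2 := hqk k
          gcongr

theorem exists_eq_mul_add_sum {K : ℕ} (f : ℝ × (Fin K → ℝ) →ₗ[ℝ] ℝ) :
    ∃ (c : ℝ) (a : Fin K → ℝ), ∀ t u, f (t, u) = c * t + ∑ k, a k * u k := by
  refine ⟨f (1, 0), fun k => f (0, fun j => if k = j then 1 else 0), fun t u => ?_⟩
  have h1 : f (t, u) = f (t • ((1 : ℝ), (0 : Fin K → ℝ))) + (f ∘ₗ LinearMap.inr ℝ ℝ _) u := by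
    rw [LinearMap.comp_apply, ← map_add]
    simp
  rw [h1, map_smul, LinearMap.pi_apply_eq_sum_univ (f ∘ₗ LinearMap.inr ℝ ℝ _) u]
  simp [mul_comm]

/-- Existence of Lagrange multipliers for the resource constraints. -/
theorem exists_lagrange_multipliers {N M K : ℕ} {W : Fin N → Fin M → Fin K → ℝ → ℝ}
    {B : Fin K → ℝ} (hconv : ∀ i j k, ConvexOn ℝ Set.univ (W i j k)) (hB : ∀ k, 0 < B k) {p : ℝ}
    (hp : ∀ x V, PrimalFeasible W B x V → ∑ i, ∑ j, x i j * V i j ≤ p) :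
    ∃ α : Fin K → ℝ, (∀ k, 0 ≤ α k) ∧ ∀ x V : Fin N → Fin M → ℝ, IsAllocation x →
      ∑ i, ∑ j, x i j * V i j - ∑ k, α k * ∑ i, ∑ j, x i j * W i j k (V i j) ≤
        p - ∑ k, α k * B k := by
  have hp0 : 0 ≤ p := by
    simpa using hp 0 0 ⟨by simp, by simp, fun k => by simpa using (hB k).le⟩
  have hmem : (p, B) ∉ strictlyAttainable W := by
    rintro ⟨x, V, ⟨hx, hx1⟩, h1, h2⟩
    exact absurd (hp x V ⟨hx, hx1, fun k => (h2 k).le⟩) (not_le.mpr h1)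
  obtain ⟨f, hf⟩ := geometric_hahn_banach_open_point (convex_strictlyAttainable hconv)
    (isOpen_strictlyAttainable W) hmem
  obtain ⟨c, a, hca⟩ := exists_eq_mul_add_sum f.toLinearMap
  have hsep : ∀ t u, (t, u) ∈ strictlyAttainable W →
      c * t + ∑ k, a k * u k < c * p + ∑ k, a k * B k := by
    intro t u h
    rw [← hca, ← hca]
    exact hf _ h
  have hpos : ∀ u : Fin K → ℝ, (∀ k, 0 < u k) → ((-1 : ℝ), u) ∈ strictlyAttainable W :=
    fun u hu => ⟨0, 0, ⟨by simp, by simp⟩, by simp, by simpa using hu⟩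
  have hc : 0 < c := by
    have := hsep _ _ (hpos B hB)
    by_contra! h
    nlinarith
  have ha : ∀ k, a k ≤ 0 := by
    intro k
    by_contra! h
    have hr : 0 ≤ c * (p + 1) / a k := by positivity
    have := hsep _ _ (hpos (B + Pi.single k (c * (p + 1) / a k)) fun l => add_pos_of_pos_of_nonneg
      (hB l) ((Pi.single_nonneg (α := fun _ => ℝ) (i := k)).mpr hr l))
    simp only [Pi.add_apply, mul_add, Finset.sum_add_distrib, Pi.single_apply, mul_ite, mul_zero,
      Finset.sum_ite_eq', Finset.mem_univ, if_true] at this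
    rw [mul_div_cancel₀ _ h.ne'] at this
    linarith
  refine ⟨fun k => -a k / c, fun k => div_nonneg (neg_nonneg.mpr (ha k)) hc.le,
    fun x V hx => ?_⟩
  have hle : c * (∑ i, ∑ j, x i j * V i j) +
      ∑ k, a k * ∑ i, ∑ j, x i j * W i j k (V i j) ≤ c * p + ∑ k, a k * B k := by
    have hlim : Filter.Tendsto (fun ε : ℝ => c * (∑ i, ∑ j, x i j * V i j - ε) +
        ∑ k, a k * (∑ i, ∑ j, x i j * W i j k (V i j) + ε)) (nhdsWithin 0 (Set.Ioi 0))
        (nhds (c * (∑ i, ∑ j, x i j * V i j - 0) +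
          ∑ k, a k * (∑ i, ∑ j, x i j * W i j k (V i j) + 0))) :=
      (Continuous.tendsto (by fun_prop) 0).mono_left nhdsWithin_le_nhds
    simp only [sub_zero, add_zero] at hlim
    refine le_of_tendsto hlim ?_
    filter_upwards [self_mem_nhdsWithin] with ε hε
    have hε : 0 < ε := hε
    exact (hsep _ (fun k => ∑ i, ∑ j, x i j * W i j k (V i j) + ε)
      ⟨x, V, hx, by simpa using hε, fun k => by simpa using hε⟩).le
  have e : ∀ y : Fin K → ℝ, ∑ k, -a k / c * y k = -(∑ k, a k * y k) / c := by
    intro y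
    rw [neg_div, Finset.sum_div, ← Finset.sum_neg_distrib]
    exact Finset.sum_congr rfl fun k _ => by ring
  rw [e, e, neg_div, neg_div, sub_neg_eq_add, sub_neg_eq_add, ← mul_le_mul_iff_right₀ hc, mul_add,
    mul_add, mul_div_cancel₀ _ hc.ne', mul_div_cancel₀ _ hc.ne']
  exact hle

/-- If all sums of values chosen coordinatewise are at most `C`, then the coordinates have upper
bounds whose sum is at most `C`. -/
theorem exists_bounds_sum_le {κ ι : Type*} [Fintype κ] [Nonempty ι] {φ : κ → ι → ℝ} {C : ℝ}
    (h : ∀ s : κ → ι, ∑ i, φ i (s i) ≤ C) :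
    ∃ β : κ → ℝ, (∀ i t, φ i t ≤ β i) ∧ ∑ i, β i ≤ C := by
  classical
  have hbdd : ∀ i, BddAbove (Set.range (φ i)) := by
    intro i
    obtain ⟨t₀⟩ := ‹Nonempty ι›
    refine ⟨C - ∑ l ∈ Finset.univ.erase i, φ l t₀, ?_⟩
    rintro _ ⟨t, rfl⟩
    have := h (Function.update (fun _ => t₀) i t)
    rw [← Finset.add_sum_erase _ _ (Finset.mem_univ i)] at this
    have e : ∑ l ∈ Finset.univ.erase i, φ l (Function.update (fun _ => t₀) i t l) =
        ∑ l ∈ Finset.univ.erase i, φ l t₀ := Finset.sum_congr rfl fun l hl => by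
      rw [Function.update_of_ne (Finset.ne_of_mem_erase hl)]
    rw [e, Function.update_self] at this
    linarith
  refine ⟨fun i => ⨆ t, φ i t, fun i t => le_ciSup (hbdd i) t, ?_⟩
  have hε : ∀ ε : ℝ, 0 < ε → ∑ i, ((⨆ t, φ i t) - ε) ≤ C := by
    intro ε hε
    have : ∀ i, ∃ t, (⨆ t, φ i t) - ε < φ i t := fun i =>
      exists_lt_of_lt_ciSup (sub_lt_self _ hε)
    choose s hs using this
    exact (Finset.sum_le_sum fun i _ => (hs i).le).trans (h s)
  have hlim : Filter.Tendsto (fun ε : ℝ => ∑ i, ((⨆ t, φ i t) - ε)) (nhdsWithin 0 (Set.Ioi 0))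
      (nhds (∑ i, ((⨆ t, φ i t) - 0))) :=
    (Continuous.tendsto (by fun_prop) 0).mono_left nhdsWithin_le_nhds
  simp only [sub_zero] at hlim
  refine le_of_tendsto hlim ?_
  filter_upwards [self_mem_nhdsWithin] with ε h
  exact hε ε h

/-- Every upper bound of the primal problem is an upper bound of some dual value. -/
theorem exists_dualFeasible_le {N M K : ℕ} {W : Fin N → Fin M → Fin K → ℝ → ℝ}
    {B : Fin K → ℝ} (hconv : ∀ i j k, ConvexOn ℝ Set.univ (W i j k)) (hB : ∀ k, 0 < B k) {p : ℝ}
    (hp : ∀ x V, PrimalFeasible W B x V → ∑ i, ∑ j, x i j * V i j ≤ p) :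
    ∃ α β, DualFeasible W α β ∧ ∑ k, α k * B k + ∑ i, β i ≤ p := by
  obtain ⟨α, hα, hL⟩ := exists_lagrange_multipliers hconv hB hp
  let φ : Fin N → Option (Fin M × ℝ) → ℝ := fun i o =>
    o.elim 0 fun q => q.2 - ∑ k, α k * W i q.1 k q.2
  have hφ : ∀ s : Fin N → Option (Fin M × ℝ), ∑ i, φ i (s i) ≤ p - ∑ k, α k * B k := by
    intro s
    let x : Fin N → Fin M → ℝ := fun i j => (s i).elim 0 fun q => if j = q.1 then 1 else 0
    let V : Fin N → Fin M → ℝ := fun i _ => (s i).elim 0 fun q => q.2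
    have hx : IsAllocation x := by
      constructor
      · intro i j
        simp only [x]
        cases s i with
        | none => simp
        | some q => simp only [Option.elim_some]; split_ifs <;> norm_num
      · intro i
        simp only [x]
        cases s i <;> simp
    refine le_trans (le_of_eq ?_) (hL x V hx)
    have e : ∀ i, φ i (s i) =
        ∑ j, x i j * V i j - ∑ k, α k * ∑ j, x i j * W i j k (V i j) := by
      intro i
      simp only [φ, x, V]
      cases s i <;> simp
    simp only [e, Finset.sum_sub_distrib, Finset.mul_sum]
    rw [Finset.sum_comm (γ := Fin K)]
  obtain ⟨β, hβ, hsum⟩ := exists_bounds_sum_le hφ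
  exact ⟨α, β, ⟨hα, fun i => hβ i none, fun i j v => hβ i (some (j, v))⟩, by linarith⟩

theorem weak_duality {N M K : ℕ} {W : Fin N → Fin M → Fin K → ℝ → ℝ} {B : Fin K → ℝ}
    {x V : Fin N → Fin M → ℝ} {α : Fin K → ℝ} {β : Fin N → ℝ}
    (hP : PrimalFeasible W B x V) (hD : DualFeasible W α β) :
    ∑ i, ∑ j, x i j * V i j ≤ ∑ k, α k * B k + ∑ i, β i := by
  obtain ⟨hx, hx1, hxB⟩ := hP
  obtain ⟨hα, hβ, hαβ⟩ := hD
  have h1 : ∑ i, ∑ j, x i j * V i j ≤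
      ∑ i, ∑ j, (x i j * ∑ k, α k * W i j k (V i j) + x i j * β i) := by
    gcongr with i _ j _
    rw [← mul_add]
    exact mul_le_mul_of_nonneg_left (by linarith [hαβ i j (V i j)]) (hx i j)
  refine h1.trans ?_
  simp only [Finset.sum_add_distrib, ← Finset.sum_mul]
  refine add_le_add ?_ (Finset.sum_le_sum fun i _ => mul_le_of_le_one_left (hβ i) (hx1 i))
  have h2 : ∑ i, ∑ j, x i j * ∑ k, α k * W i j k (V i j) =
      ∑ k, α k * ∑ i, ∑ j, x i j * W i j k (V i j) := by
    simp only [Finset.mul_sum]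
    rw [Finset.sum_comm (γ := Fin K)]
    refine Finset.sum_congr rfl fun i _ => ?_
    rw [Finset.sum_comm (γ := Fin K)]
    exact Finset.sum_congr rfl fun j _ => Finset.sum_congr rfl fun k _ => by ring
  rw [h2]
  exact Finset.sum_le_sum fun k _ => mul_le_mul_of_nonneg_left (hxB k) (hα k)

theorem mmkp_strong_duality
    (N M K : ℕ)
    (W : Fin N → Fin M → Fin K → ℝ → ℝ) (B : Fin K → ℝ)
    (hconv : ∀ i j k, ConvexOn ℝ Set.univ (W i j k))
    (hcont : ∀ i j k, Continuous (W i j k))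
    (hzero : ∀ i j k, W i j k 0 = 0)
    (hB : ∀ k, 0 < B k) :
    sSup {r : EReal | ∃ x V : Fin N → Fin M → ℝ,
          PrimalFeasible W B x V ∧ r = ((∑ i, ∑ j, x i j * V i j : ℝ) : EReal)}
      = sInf {r : EReal | ∃ (α : Fin K → ℝ) (β : Fin N → ℝ),
          DualFeasible W α β ∧ r = ((∑ k, α k * B k + ∑ i, β i : ℝ) : EReal)} := by
  apply le_antisymm
  · refine sSup_le ?_
    rintro _ ⟨x, V, hP, rfl⟩
    refine le_sInf ?_
    rintro _ ⟨α, β, hD, rfl⟩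
    exact EReal.coe_le_coe_iff.mpr (weak_duality hP hD)
  · set S := {r : EReal | ∃ x V : Fin N → Fin M → ℝ,
          PrimalFeasible W B x V ∧ r = ((∑ i, ∑ j, x i j * V i j : ℝ) : EReal)}
    have hle : ∀ x V, PrimalFeasible W B x V →
        ((∑ i, ∑ j, x i j * V i j : ℝ) : EReal) ≤ sSup S :=
      fun x V h => le_sSup ⟨x, V, h, rfl⟩
    induction h : sSup S with
    | bot =>
      have := hle 0 0 ⟨by simp, by simp, fun k => by simpa using (hB k).le⟩
      rw [h] at this
      exact absurd (le_bot_iff.mp this) (EReal.coe_ne_bot _)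
    | top => exact le_top
    | coe p =>
      obtain ⟨α, β, hD, hαβ⟩ := exists_dualFeasible_le hconv hB (p := p) fun x V hP => by
        have := hle x V hP
        rw [h] at this
        exact EReal.coe_le_coe_iff.mp this
      exact sInf_le_of_le ⟨α, β, hD, rfl⟩ (EReal.coe_le_coe_iff.mpr hαβ)
end

section
/- Optimality of the chosen gain: suppose (x, V) is primal feasible and (α, β) is dual feasible for the augmented MMKP, and the primal and dual objective values are equal: Σ_{i,j} x i j · V i j = Σ_k α k · B k + Σ_i β i. Then for every i and j with x i j > 0, the value V i j attains the supremum S i j (α) = sup_{v ∈ ℝ} (v − Σ_k α k · W i j k v); that is, V i j − Σ_k α k · W i j k (V i j) = S i j (α). -/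
theorem mmkp_gain_optimality
    (N M K : ℕ)
    (W : Fin N → Fin M → Fin K → ℝ → ℝ) (B : Fin K → ℝ)
    (x V : Fin N → Fin M → ℝ)
    (hx : ∀ i j, 0 ≤ x i j)
    (hrow : ∀ i, ∑ j, x i j ≤ 1)
    (hres : ∀ k, ∑ i, ∑ j, x i j * W i j k (V i j) ≤ B k)
    (α : Fin K → ℝ) (β : Fin N → ℝ)
    (hα : ∀ k, 0 ≤ α k) (hβ : ∀ i, 0 ≤ β i)
    (hscore : ∀ i j (v : ℝ), v - ∑ k, α k * W i j k v ≤ β i)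
    (heq : ∑ i, ∑ j, x i j * V i j = ∑ k, α k * B k + ∑ i, β i)
    (S : Fin N → Fin M → (Fin K → ℝ) → ℝ)
    (hS : ∀ i j a, S i j a = ⨆ v : ℝ, (v - ∑ k, a k * W i j k v))
    : ∀ i j, 0 < x i j →
      V i j - ∑ k, α k * W i j k (V i j) = S i j α := by
  have hweights : ∑ i, ∑ j, x i j * ∑ k, α k * W i j k (V i j)
      = ∑ k, α k * ∑ i, ∑ j, x i j * W i j k (V i j) := by
    simp only [Finset.mul_sum]
    simp_rw [fun i : Fin N => Finset.sum_comm (s := (Finset.univ : Finset (Fin M)))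
      (t := (Finset.univ : Finset (Fin K)))
      (f := fun j k => x i j * (α k * W i j k (V i j)))]
    rw [Finset.sum_comm]
    simp only [mul_left_comm]
  have hcost : ∑ k, α k * ∑ i, ∑ j, x i j * W i j k (V i j) ≤ ∑ k, α k * B k :=
    Finset.sum_le_sum fun k _ => mul_le_mul_of_nonneg_left (hres k) (hα k)
  have hrows : ∑ i, ∑ j, x i j * β i ≤ ∑ i, β i := by
    refine Finset.sum_le_sum fun i _ => ?_
    rw [← Finset.sum_mul]
    exact mul_le_of_le_one_left (hβ i) (hrow i)
  have hslack_nonneg : ∀ i j,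
      0 ≤ x i j * (β i - (V i j - ∑ k, α k * W i j k (V i j))) := fun i j =>
    mul_nonneg (hx i j) (sub_nonneg.2 (hscore i j _))
  have hslack_sum :
      ∑ i, ∑ j, x i j * (β i - (V i j - ∑ k, α k * W i j k (V i j))) ≤ 0 := by
    simp only [mul_sub, Finset.sum_sub_distrib]
    linarith
  intro i j hij
  have hslack : x i j * (β i - (V i j - ∑ k, α k * W i j k (V i j))) ≤ 0 :=
    calc _ ≤ ∑ j', x i j' * (β i - (V i j' - ∑ k, α k * W i j' k (V i j'))) :=
          Finset.single_le_sum (fun j' _ => hslack_nonneg i j') (Finset.mem_univ j)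
      _ ≤ _ := Finset.single_le_sum
          (f := fun i' => ∑ j', x i' j' * (β i' - (V i' j' - ∑ k, α k * W i' j' k (V i' j'))))
          (fun i' _ => Finset.sum_nonneg fun j' _ => hslack_nonneg i' j') (Finset.mem_univ i)
      _ ≤ 0 := hslack_sum
  have hβ_le : β i ≤ V i j - ∑ k, α k * W i j k (V i j) :=
    sub_nonpos.1 (nonpos_of_mul_nonpos_right hslack hij)
  rw [hS]
  refine le_antisymm ?_ (ciSup_le fun v => (hscore i j v).trans hβ_le)
  exact le_ciSup (f := fun v : ℝ => v - ∑ k, α k * W i j k v)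
    ⟨β i, Set.forall_mem_range.2 (hscore i j)⟩ (V i j)
end

section
/- Discarding negative-score users: suppose (x, V) is primal feasible and (α, β) is dual feasible for the augmented MMKP with equal primal and dual objective values. If S i j (α) < 0 for some item i and user j, where S i j (α) = sup_{v ∈ ℝ} (v − Σ_k α k · W i j k v), then x i j = 0; that is, item i should not be distributed to user j. -/
theorem mmkp_discard_negative_score
    (N M K : ℕ)
    (W : Fin N → Fin M → Fin K → ℝ → ℝ) (B : Fin K → ℝ)
    (x V : Fin N → Fin M → ℝ)
    (hx : ∀ i j, 0 ≤ x i j)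
    (hrow : ∀ i, ∑ j, x i j ≤ 1)
    (hres : ∀ k, ∑ i, ∑ j, x i j * W i j k (V i j) ≤ B k)
    (α : Fin K → ℝ) (β : Fin N → ℝ)
    (hα : ∀ k, 0 ≤ α k) (hβ : ∀ i, 0 ≤ β i)
    (hscore : ∀ i j (v : ℝ), v - ∑ k, α k * W i j k v ≤ β i)
    (heq : ∑ i, ∑ j, x i j * V i j = ∑ k, α k * B k + ∑ i, β i)
    (S : Fin N → Fin M → (Fin K → ℝ) → ℝ)
    (hS : ∀ i j a, S i j a = ⨆ v : ℝ, (v - ∑ k, a k * W i j k v))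
    : ∀ i j, S i j α < 0 → x i j = 0 := by
  intro i₀ j₀ hneg
  have hreduced : V i₀ j₀ - ∑ k, α k * W i₀ j₀ k (V i₀ j₀) < 0 := by
    rw [hS] at hneg
    refine lt_of_le_of_lt ?_ hneg
    exact le_ciSup (f := fun v : ℝ => v - ∑ k, α k * W i₀ j₀ k v)
      ⟨β i₀, by rintro _ ⟨v, rfl⟩; exact hscore i₀ j₀ v⟩ (V i₀ j₀)
  by_contra hne
  have hpos : 0 < x i₀ j₀ := lt_of_le_of_ne (hx i₀ j₀) (Ne.symm hne)
  have hle : ∀ i j, x i j * (V i j - ∑ k, α k * W i j k (V i j)) ≤ x i j * β i :=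
    fun i j => mul_le_mul_of_nonneg_left (hscore i j (V i j)) (hx i j)
  have hlt : ∑ i, ∑ j, x i j * (V i j - ∑ k, α k * W i j k (V i j))
      < ∑ i, ∑ j, x i j * β i := by
    refine Finset.sum_lt_sum (fun i _ => Finset.sum_le_sum fun j _ => hle i j)
      ⟨i₀, Finset.mem_univ _, ?_⟩
    exact Finset.sum_lt_sum (fun j _ => hle i₀ j) ⟨j₀, Finset.mem_univ _,
      mul_lt_mul_of_pos_left (hreduced.trans_le (hβ i₀)) hpos⟩
  have hrows : ∑ i, ∑ j, x i j * β i ≤ ∑ i, β i := by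
    refine Finset.sum_le_sum fun i _ => ?_
    rw [← Finset.sum_mul]
    exact mul_le_of_le_one_left (hβ i) (hrow i)
  have hcost : ∑ i, ∑ j, x i j * ∑ k, α k * W i j k (V i j) ≤ ∑ k, α k * B k := by
    calc ∑ i, ∑ j, x i j * ∑ k, α k * W i j k (V i j)
        = ∑ k, α k * ∑ i, ∑ j, x i j * W i j k (V i j) := by
          simp only [Finset.mul_sum]
          rw [Finset.sum_comm (s := (Finset.univ : Finset (Fin K)))]
          refine Finset.sum_congr rfl fun i _ => ?_
          rw [Finset.sum_comm]
          exact Finset.sum_congr rfl fun k _ => Finset.sum_congr rfl fun j _ => by ring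
      _ ≤ ∑ k, α k * B k :=
          Finset.sum_le_sum fun k _ => mul_le_mul_of_nonneg_left (hres k) (hα k)
  simp only [mul_sub, Finset.sum_sub_distrib] at hlt
  linarith
end

section
/- Discarding dominated users: suppose (x, V) is primal feasible and (α, β) is dual feasible for the augmented MMKP with equal primal and dual objective values. If for some item i and users j₁, j₂ one has S i j₁ (α) < S i j₂ (α), where S i j (α) = sup_{v ∈ ℝ} (v − Σ_k α k · W i j k v), then x i j₁ = 0; that is, item i should not be distributed to the dominated user j₁. -/
theorem mmkp_discard_dominated
    (N M K : ℕ)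
    (W : Fin N → Fin M → Fin K → ℝ → ℝ) (B : Fin K → ℝ)
    (x V : Fin N → Fin M → ℝ)
    (hx : ∀ i j, 0 ≤ x i j)
    (hrow : ∀ i, ∑ j, x i j ≤ 1)
    (hres : ∀ k, ∑ i, ∑ j, x i j * W i j k (V i j) ≤ B k)
    (α : Fin K → ℝ) (β : Fin N → ℝ)
    (hα : ∀ k, 0 ≤ α k) (hβ : ∀ i, 0 ≤ β i)
    (hscore : ∀ i j (v : ℝ), v - ∑ k, α k * W i j k v ≤ β i)
    (heq : ∑ i, ∑ j, x i j * V i j = ∑ k, α k * B k + ∑ i, β i)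
    (S : Fin N → Fin M → (Fin K → ℝ) → ℝ)
    (hS : ∀ i j a, S i j a = ⨆ v : ℝ, (v - ∑ k, a k * W i j k v))
    : ∀ i (j₁ j₂ : Fin M), S i j₁ α < S i j₂ α → x i j₁ = 0 := by
  intro i j₁ j₂ hlt
  have hres_le : ∑ i, ∑ j, x i j * ∑ k, α k * W i j k (V i j) ≤ ∑ k, α k * B k := by
    calc ∑ i, ∑ j, x i j * ∑ k, α k * W i j k (V i j)
        = ∑ k, α k * ∑ i, ∑ j, x i j * W i j k (V i j) := by
          simp only [Finset.mul_sum]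
          conv_rhs => rw [Finset.sum_comm]
          refine Finset.sum_congr rfl fun i _ => ?_
          rw [Finset.sum_comm]
          exact Finset.sum_congr rfl fun k _ => Finset.sum_congr rfl fun j _ => by ring
      _ ≤ ∑ k, α k * B k :=
          Finset.sum_le_sum fun k _ => mul_le_mul_of_nonneg_left (hres k) (hα k)
  have hrow_le : ∑ i, ∑ j, x i j * β i ≤ ∑ i, β i := by
    refine Finset.sum_le_sum fun i _ => ?_
    rw [← Finset.sum_mul]
    exact mul_le_of_le_one_left (hβ i) (hrow i)
  have hslack_nonneg : ∀ i j, 0 ≤ x i j * (β i - (V i j - ∑ k, α k * W i j k (V i j))) :=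
    fun i j => mul_nonneg (hx i j) (sub_nonneg.2 (hscore i j (V i j)))
  have hslack_sum :
      ∑ i, ∑ j, x i j * (β i - (V i j - ∑ k, α k * W i j k (V i j))) ≤ 0 := by
    simp only [mul_sub, Finset.sum_sub_distrib]
    linarith
  have hslack_le : x i j₁ * (β i - (V i j₁ - ∑ k, α k * W i j₁ k (V i j₁))) ≤ 0 :=
    ((Finset.single_le_sum (fun j _ => hslack_nonneg i j) (Finset.mem_univ j₁)).trans
      (Finset.single_le_sum
        (f := fun i => ∑ j, x i j * (β i - (V i j - ∑ k, α k * W i j k (V i j))))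
        (fun i _ => Finset.sum_nonneg fun j _ => hslack_nonneg i j)
        (Finset.mem_univ i))).trans hslack_sum
  refine (mul_eq_zero.1 (hslack_le.antisymm (hslack_nonneg i j₁))).resolve_right fun htight => ?_
  have hS₂ : S i j₂ α ≤ β i := by
    rw [hS]
    exact ciSup_le (hscore i j₂)
  have hS₁ : V i j₁ - ∑ k, α k * W i j₁ k (V i j₁) ≤ S i j₁ α := by
    rw [hS]
    exact le_ciSup (f := fun v : ℝ => v - ∑ k, α k * W i j₁ k v)
      ⟨β i, Set.forall_mem_range.2 (hscore i j₁)⟩ (V i j₁)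
  linarith
end

section
/- Full distribution of positive-score items: suppose (x, V) is primal feasible and (α, β) is dual feasible for the augmented MMKP with equal primal and dual objective values. If for some item i there exists a user j with S i j (α) > 0, where S i j (α) = sup_{v ∈ ℝ} (v − Σ_k α k · W i j k v), then Σ_j x i j = 1; that is, item i should not be discarded. -/
theorem mmkp_full_distribution
    (N M K : ℕ)
    (W : Fin N → Fin M → Fin K → ℝ → ℝ) (B : Fin K → ℝ)
    (x V : Fin N → Fin M → ℝ)
    (hx : ∀ i j, 0 ≤ x i j)
    (hrow : ∀ i, ∑ j, x i j ≤ 1)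
    (hres : ∀ k, ∑ i, ∑ j, x i j * W i j k (V i j) ≤ B k)
    (α : Fin K → ℝ) (β : Fin N → ℝ)
    (hα : ∀ k, 0 ≤ α k) (hβ : ∀ i, 0 ≤ β i)
    (hscore : ∀ i j (v : ℝ), v - ∑ k, α k * W i j k v ≤ β i)
    (heq : ∑ i, ∑ j, x i j * V i j = ∑ k, α k * B k + ∑ i, β i)
    (S : Fin N → Fin M → (Fin K → ℝ) → ℝ)
    (hS : ∀ i j a, S i j a = ⨆ v : ℝ, (v - ∑ k, a k * W i j k v))
    : ∀ i, (∃ j, 0 < S i j α) → ∑ j, x i j = 1 := by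
  rintro i₀ ⟨j₀, hpos⟩
  have hβpos : 0 < β i₀ := by
    rw [hS] at hpos
    exact hpos.trans_le (ciSup_le (hscore i₀ j₀))
  have hcost : ∑ i, ∑ j, x i j * ∑ k, α k * W i j k (V i j) ≤ ∑ k, α k * B k := by
    calc ∑ i, ∑ j, x i j * ∑ k, α k * W i j k (V i j)
        = ∑ i, ∑ k, ∑ j, α k * (x i j * W i j k (V i j)) := by
          refine Finset.sum_congr rfl fun i _ => ?_
          rw [Finset.sum_comm]
          refine Finset.sum_congr rfl fun j _ => ?_
          rw [Finset.mul_sum]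
          exact Finset.sum_congr rfl fun k _ => by ring
      _ = ∑ k, α k * ∑ i, ∑ j, x i j * W i j k (V i j) := by
          rw [Finset.sum_comm]
          simp only [Finset.mul_sum]
      _ ≤ ∑ k, α k * B k :=
          Finset.sum_le_sum fun k _ => mul_le_mul_of_nonneg_left (hres k) (hα k)
  have hvalue : ∑ i, ∑ j, x i j * V i j ≤
      ∑ i, ∑ j, x i j * ∑ k, α k * W i j k (V i j) + ∑ i, β i * ∑ j, x i j := by
    rw [← Finset.sum_add_distrib]
    refine Finset.sum_le_sum fun i _ => ?_
    rw [Finset.mul_sum, ← Finset.sum_add_distrib]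
    refine Finset.sum_le_sum fun j _ => ?_
    have h := mul_le_mul_of_nonneg_left (hscore i j (V i j)) (hx i j)
    linarith
  by_contra hne
  have hlt : ∑ i, β i * ∑ j, x i j < ∑ i, β i :=
    Finset.sum_lt_sum (fun i _ => mul_le_of_le_one_right (hβ i) (hrow i))
      ⟨i₀, Finset.mem_univ _, mul_lt_of_lt_one_right hβpos (lt_of_le_of_ne (hrow i₀) hne)⟩
  linarith
end
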